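/- Let ℓ ≥ 1 and 0 ≤ m ≤ ℓ. For every strict partition μ ∈ F_1^m(Λ_ℓ), the product δ_2(μ^b[1])·δ̄_3(μ) equals (−1)^{C(m,2)} if 0 ≤ m ≤ ℓ/2, and equals (−1)^{C(ℓ−m+1,2)+(ℓ−m)m} if ℓ/2 ≤ m ≤ ℓ. -/

import Mathlib

open scoped BigOperators

/-- A partition, represented canonically as the multiset of its (positive) parts. -/
structure Ptn where
  parts : Multiset ℕ
  pos : ∀ x ∈ parts, 0 < x

namespace Ptn

/-- Build a partition from an arbitrary multiset of naturals by discarding zero parts. -/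
def of (s : Multiset ℕ) : Ptn :=
  ⟨s.filter (fun x => 0 < x), fun _ hx => (Multiset.mem_filter.mp hx).2⟩

/-- The empty partition. -/
def empty : Ptn := ⟨0, by simp⟩

/-- The `i`-th largest part (`0`-indexed); `0` if `i` is at least the number of parts. -/
def part (l : Ptn) (i : ℕ) : ℕ :=
  ((l.parts.sort (· ≤ ·)).reverse).getD i 0

/-- The number of (positive) parts. -/
def length (l : Ptn) : ℕ := Multiset.card l.parts

/-- The size `|λ|`, i.e. the number being partitioned. -/
def size (l : Ptn) : ℕ := l.parts.sum

/-- A partition is strict if all its parts are distinct. -/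
def Strict (l : Ptn) : Prop := l.parts.Nodup

/-- The conjugate partition. -/
def conj (l : Ptn) : Ptn :=
  of ((Multiset.range (l.part 0)).map
    (fun j => Multiset.card (l.parts.filter (fun x => j < x))))

end Ptn

/-- The rectangular partition `□(n,m)` with `n` rows of length `m`. -/
def rect (n m : ℕ) : Ptn := Ptn.of (Multiset.replicate n m)

/-- The partition obtained by multiplying every part by `r`. -/
def scaleP (r : ℕ) (l : Ptn) : Ptn := Ptn.of (l.parts.map (fun a => r * a))

/-- Diagram containment: every part of `small` is at most the corresponding part of `big`. -/
def Contains (big small : Ptn) : Prop := ∀ i, small.part i ≤ big.part i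

/-- The beta-set (first-column hook lengths) `{λ_i + m - 1 - i : i < m}` of `l`,
computed with `m` beads (`m` at least the number of parts). -/
def betaSet (l : Ptn) (m : ℕ) : Finset ℕ :=
  (Finset.range m).image (fun i => l.part i + (m - 1 - i))

/-- The partition encoded by a finite set of bead positions: each bead contributes a part
equal to the number of empty positions (holes) below it. -/
def ptnOfBeads (B : Finset ℕ) : Ptn :=
  Ptn.of (B.val.map (fun p => p - (B.filter (fun q => q < p)).card))

/-- Levels of the beads on runner `k` of the `r`-abacus of `l`,
drawn with `r * l.length` beads (a multiple of `r`). -/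
def runnerLevels (r : ℕ) (l : Ptn) (k : ℕ) : Finset ℕ :=
  (Finset.range (l.part 0 + r * l.length + 1)).filter
    (fun s => r * s + k ∈ betaSet l (r * l.length))

/-- The `k`-th component `λ[k]` of the `r`-quotient of `l`. -/
def quotP (r : ℕ) (l : Ptn) (k : ℕ) : Ptn := ptnOfBeads (runnerLevels r l k)

/-- The `r`-core of `l`: push all beads of the `r`-abacus down as far as possible. -/
def coreP (r : ℕ) (l : Ptn) : Ptn :=
  ptnOfBeads ((Finset.range r).biUnion
    (fun k => (Finset.range (runnerLevels r l k).card).image (fun s => r * s + k)))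

/-- The key of the bead at position `p` for the `r`-numbering of the beads `B`:
a bead which is the `j`-th lowest bead on runner `k` gets key `r * j + k`. -/
def rKey (r : ℕ) (B : Finset ℕ) (p : ℕ) : ℕ :=
  r * (B.filter (fun q => q % r = p % r ∧ q < p)).card + p % r

/-- The number of inversions between the natural (increasing-position) numbering of the
beads `B` and the numbering by increasing `key`. -/
def inversions (key : ℕ → ℕ) (B : Finset ℕ) : ℕ :=
  ((B ×ˢ B).filter (fun pq => pq.1 < pq.2 ∧ key pq.2 < key pq.1)).card

/-- Exponent of the `r`-sign `δ_r`. -/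
def rSignExp (r : ℕ) (l : Ptn) : ℕ :=
  inversions (rKey r (betaSet l (r * l.length))) (betaSet l (r * l.length))

/-- The `r`-sign `δ_r(λ) ∈ {±1}`. -/
def rSign (r : ℕ) (l : Ptn) : ℤ := (-1) ^ rSignExp r l

/-- The key of the bead at position `p` for the `3`-bar numbering of the beads `B` of the
`3`-bar abacus: first the beads of runner `0` in increasing order, then the pairs of beads
on runners `2` and `1` paired off by increasing level (runner-`2` bead before
runner-`1` bead), then the remaining unpaired beads in increasing order. -/
def barKey (B : Finset ℕ) (p : ℕ) : ℕ :=
  let n0 := (B.filter (fun q => q % 3 = 0)).card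
  let t := min ((B.filter (fun q => q % 3 = 1)).card)
              ((B.filter (fun q => q % 3 = 2)).card)
  let rk := (B.filter (fun q => q % 3 = p % 3 ∧ q < p)).card
  if p % 3 = 0 then rk
  else if rk < t then (if p % 3 = 2 then n0 + 2 * rk else n0 + 2 * rk + 1)
  else n0 + 2 * t + (rk - t)

/-- Exponent of the `3`-bar sign `δ̄_3`.  The beads of the `3`-bar abacus of a strict
partition sit at the positions given by the parts. -/
def barSignExp (l : Ptn) : ℕ :=
  inversions (barKey l.parts.toFinset) l.parts.toFinset

/-- The `3`-bar sign `δ̄_3(λ) ∈ {±1}` of a strict partition. -/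
def barSign3 (l : Ptn) : ℤ := (-1) ^ barSignExp l

/-- The double `D(λ) = (λ_1,…,λ_l | λ_1 - 1,…,λ_l - 1)` (Frobenius notation)
of a strict partition `λ`, constructed row by row. -/
noncomputable def double (l : Ptn) : Ptn :=
  Ptn.of ((Multiset.range (l.length + l.part 0)).map (fun i =>
    (if i < l.length then l.part i + 1 else 0) +
      ((Finset.range (min i l.length)).filter (fun j => i + 1 ≤ j + l.part j)).card))

/-- The second component `λ^b[1] = D(λ)[1]` of the `3`-bar quotient of a strict
partition `λ`. -/
noncomputable def barQuot1 (l : Ptn) : Ptn := quotP 3 (double l) 1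

/-- The staircase-like strict partition `Λ_ℓ = (3ℓ-2, 3ℓ-5, …, 7, 4, 1)`. -/
def LamP (ℓ : ℕ) : Ptn := Ptn.of ((Multiset.range ℓ).map (fun i => 3 * i + 1))

/-- The staircase partition `Δ_ℓ = (ℓ, ℓ-1, …, 1)`. -/
def DelP (ℓ : ℕ) : Ptn := Ptn.of (Multiset.range (ℓ + 1))

/-- `F_1^m(Λ_ℓ)`: strict partitions obtained from `Λ_ℓ` by adding `m` cells, each
labelled `1`, where the cell in (0-indexed) column `j` is labelled `1` iff `j % 3 = 1`
(each row reads `0,1,0,0,1,0,…`). -/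
def F1Lam (ℓ m : ℕ) : Set Ptn :=
  {mu | mu.Strict ∧ Contains mu (LamP ℓ) ∧ mu.size = (LamP ℓ).size + m ∧
    ∀ i j, (LamP ℓ).part i ≤ j → j < mu.part i → j % 3 = 1}

/-- `F_1^m(Δ_ℓ)`: partitions obtained from `Δ_ℓ` by adding `m` cells, each labelled `1`,
where the cell `(i,j)` is labelled `1` iff `i + j` is odd. -/
def F1Del (ℓ m : ℕ) : Set Ptn :=
  {mu | Contains mu (DelP ℓ) ∧ mu.size = (DelP ℓ).size + m ∧
    ∀ i j, (DelP ℓ).part i ≤ j → j < mu.part i → (i + j) % 2 = 1}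

/-- `(α, β)` is complementary relative to the rectangle `□(n,m)`:
`α ⊆ □(n,m)` and `β_i = m - α_{n+1-i}` for `1 ≤ i ≤ n` (0-indexed below). -/
def Complementary (n m : ℕ) (a b : Ptn) : Prop :=
  a.length ≤ n ∧ a.part 0 ≤ m ∧ b.length ≤ n ∧
    ∀ i < n, b.part i = m - a.part (n - 1 - i)

/-- `W(n,m)`: the set of `(n,m)`-balanced partitions, i.e. partitions of `2nm` with at
most `2n` parts satisfying `μ_i + μ_{2n+1-i} = 2m` for `1 ≤ i ≤ n` (0-indexed below). -/
def W (n m : ℕ) : Set Ptn :=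
  {mu | mu.size = 2 * n * m ∧ mu.length ≤ 2 * n ∧
    ∀ i < n, mu.part i + mu.part (2 * n - 1 - i) = 2 * m}

/-! ### The ring of symmetric functions

We realise the ring of symmetric functions (with rational coefficients) as the
polynomial ring `ℚ[p_1, p_2, …]` in the power sums: the variable `X n` of
`MvPolynomial ℕ ℚ` stands for the power sum `p_{n+1}`. -/

abbrev SymF := MvPolynomial ℕ ℚ

open MvPolynomial

/-- `z_ρ = ∏ a^{m_a} m_a!` for a partition given as a multiset `ρ`. -/
def zval (s : Multiset ℕ) : ℚ :=
  s.toFinset.prod (fun a => (a : ℚ) ^ s.count a * (Nat.factorial (s.count a) : ℚ))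

/-- The power sum product `p_ρ` of a multiset `ρ`. -/
noncomputable def pMult (s : Multiset ℕ) : SymF :=
  (s.map (fun a => (X (a - 1) : SymF))).prod

/-- The complete homogeneous symmetric function `h_n = Σ_{ρ ⊢ n} z_ρ⁻¹ p_ρ`. -/
noncomputable def hSym (n : ℕ) : SymF :=
  ∑ ρ : Nat.Partition n, (zval ρ.parts)⁻¹ • pMult ρ.parts

/-- `h_k` for an integer index, vanishing for negative `k`. -/
noncomputable def hz (k : ℤ) : SymF := if k < 0 then 0 else hSym k.toNat

/-- The Schur function `S_λ`, via the Jacobi–Trudi formula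
`S_λ = det(h_{λ_i - i + j})`. -/
noncomputable def schur (l : Ptn) : SymF :=
  Matrix.det (Matrix.of (fun i j : Fin l.length =>
    hz ((l.part i.val : ℤ) + (j.val : ℤ) - (i.val : ℤ))))

/-- The plethysm `p_r ∘ f`: the algebra endomorphism sending each power sum `p_k`
to `p_{rk}`, i.e. substituting `x_i^r` for each variable `x_i`. -/
noncomputable def pleth (r : ℕ) (f : SymF) : SymF :=
  MvPolynomial.aeval (fun n => (X (r * (n + 1) - 1) : SymF)) f

/-- The `z`-weight of a power-sum monomial (exponent vector `d`). -/
def zfac (d : ℕ →₀ ℕ) : ℚ :=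
  d.prod (fun i e => ((i : ℚ) + 1) ^ e * (Nat.factorial e : ℚ))

/-- The Hall inner product, for which `⟨p_ρ, p_σ⟩ = δ_{ρσ} z_ρ` and the Schur
functions are orthonormal. -/
noncomputable def hall (f g : SymF) : ℚ :=
  f.support.sum (fun d => f.coeff d * g.coeff d * zfac d)

/-- The multi-Littlewood–Richardson coefficient `LR^λ_{μ^0,…,μ^{r-1}}`:
the multiplicity of `S_λ` in `S_{μ^0} ⋯ S_{μ^{r-1}}`. -/
noncomputable def LRmulti (lam : Ptn) (r : ℕ) (q : ℕ → Ptn) : ℚ :=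
  hall ((Finset.range r).prod (fun k => schur (q k))) (schur lam)

/-- The Littlewood–Richardson coefficient `LR^λ_{α,β}`:
the multiplicity of `S_λ` in `S_α · S_β`. -/
noncomputable def LR2 (lam a b : Ptn) : ℚ := hall (schur a * schur b) (schur lam)

/-- The irreducible symmetric group character `χ^μ(ρ)`, via the Frobenius formula
`χ^μ_ρ = ⟨S_μ, p_ρ⟩`. -/
noncomputable def chi (mu rho : Ptn) : ℚ := hall (schur mu) (pMult rho.parts)

/-- Symmetric functions in two alphabets `u`, `v`: `X (inl n)` is `p_{n+1}(u)` and
`X (inr n)` is `p_{n+1}(v)`. -/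
abbrev SymF2 := MvPolynomial (ℕ ⊕ ℕ) ℚ

/-- `f ↦ f(u)`. -/
noncomputable def toU : SymF →ₐ[ℚ] SymF2 :=
  aeval (fun n => (X (Sum.inl n) : SymF2))

/-- `f ↦ f(v)`. -/
noncomputable def toV : SymF →ₐ[ℚ] SymF2 :=
  aeval (fun n => (X (Sum.inr n) : SymF2))

/-- `f ↦ f(u - v)`, the difference of alphabets: `p_k ↦ p_k(u) - p_k(v)`. -/
noncomputable def toUV : SymF →ₐ[ℚ] SymF2 :=
  aeval (fun n => (X (Sum.inl n) : SymF2) - X (Sum.inr n))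

/-- In a decreasing list, the `i`-th entry exceeds `j` exactly when more than `i` entries do. -/
theorem List.lt_getD_iff_of_pairwise_ge (L : List ℕ) (hL : L.Pairwise (· ≥ ·)) (i j : ℕ) :
    j < L.getD i 0 ↔ i < (L.filter (fun x => j < x)).length := by
  induction L generalizing i with
  | nil => simp
  | cons a L ih =>
    rw [List.pairwise_cons] at hL
    by_cases ha : j < a
    · cases i with
      | zero => simp [ha]
      | succ i => simpa [ha] using ih hL.2 i
    · have h0 : (a :: L).filter (fun x => decide (j < x)) = [] := by
        rw [List.filter_eq_nil_iff]
        intro x hx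
        rcases List.mem_cons.1 hx with rfl | hx
        · simpa using ha
        · have := hL.1 x hx
          simp; omega
      rw [h0]
      cases i with
      | zero => simpa using ha
      | succ i =>
        have := ih hL.2 i
        rw [List.filter_cons_of_neg (by simpa using ha)] at h0
        rw [h0] at this
        simpa using this

namespace Ptn

/-- Conjugation: the `i`-th part exceeds `j` exactly when more than `i` parts do. -/
theorem lt_part_iff (l : Ptn) (i j : ℕ) :
    j < l.part i ↔ i < Multiset.card (l.parts.filter (fun x => j < x)) := by
  have h := List.lt_getD_iff_of_pairwise_ge ((l.parts.sort (· ≤ ·)).reverse)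
    (by
      rw [List.pairwise_reverse]
      exact Multiset.pairwise_sort l.parts (· ≤ ·)) i j
  unfold part
  rw [h]
  conv_rhs => rw [← Multiset.sort_eq l.parts (· ≤ ·)]
  rw [Multiset.filter_coe, Multiset.coe_card, List.filter_reverse, List.length_reverse]

theorem part_pos_iff (l : Ptn) (i : ℕ) : 0 < l.part i ↔ i < l.length := by
  rw [lt_part_iff, Multiset.filter_eq_self.2 l.pos, length]

theorem part_antitone (l : Ptn) : Antitone l.part := by
  intro i k hik
  by_contra! h
  have h1 := (lt_part_iff l k (l.part i)).1 h
  exact lt_irrefl _ ((lt_part_iff l i (l.part i)).2 (by omega))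

theorem parts_eq_map (l : Ptn) : l.parts = (Multiset.range l.length).map l.part := by
  have h : (l.parts.sort (· ≤ ·)).reverse = (List.range l.length).map l.part := by
    apply List.ext_getElem
    · simp [length]
    · intro i h1 h2
      rw [List.getElem_map, List.getElem_range, part, List.getD_eq_getElem _ _ h1]
  have h' := congrArg (fun L : List ℕ => (L : Multiset ℕ)) h
  simpa [Multiset.range] using h'

theorem mem_parts_iff (l : Ptn) (x : ℕ) : x ∈ l.parts ↔ ∃ i < l.length, l.part i = x := by
  conv_lhs => rw [parts_eq_map]
  simp

theorem size_eq_sum (l : Ptn) : l.size = ∑ i ∈ Finset.range l.length, l.part i := by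
  unfold size
  conv_lhs => rw [parts_eq_map]
  rfl

theorem part_of_map_range {f : ℕ → ℕ} (hf : Antitone f) {n : ℕ} (hn : ∀ i, n ≤ i → f i = 0)
    (i : ℕ) : (of ((Multiset.range n).map f)).part i = f i := by
  refine eq_of_forall_lt_iff fun j => ?_
  rw [lt_part_iff]
  have h : Multiset.card ((of ((Multiset.range n).map f)).parts.filter (fun x => j < x)) =
      ((Finset.range n).filter (fun k => j < f k)).card := by
    simp only [of, Multiset.filter_filter, Multiset.filter_map, Multiset.card_map]
    rw [Finset.card_def, Finset.filter_val, Finset.range_val]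
    congr 1
    refine Multiset.filter_congr fun x _ => ?_
    simp only [Function.comp]; omega
  rw [h]
  constructor
  · intro hi
    by_contra! hj
    have : (Finset.range n).filter (fun k => j < f k) ⊆ Finset.range i := by
      intro k hk
      rw [Finset.mem_filter] at hk
      rw [Finset.mem_range]
      by_contra! hik
      have := hf hik
      omega
    have := Finset.card_le_card this
    rw [Finset.card_range] at this
    omega
  · intro hj
    have : Finset.range (i + 1) ⊆ (Finset.range n).filter (fun k => j < f k) := by
      intro k hk
      rw [Finset.mem_range] at hk
      have h1 := hf (show k ≤ i by omega)
      rw [Finset.mem_filter, Finset.mem_range]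
      refine ⟨?_, by omega⟩
      by_contra! hk
      have := hn k hk
      omega
    have := Finset.card_le_card this
    rw [Finset.card_range] at this
    omega

theorem Strict.part_lt {l : Ptn} (hl : l.Strict) {i k : ℕ} (hik : i < k) (hi : i < l.length) :
    l.part k < l.part i := by
  rcases Nat.lt_or_ge k l.length with hk | hk
  · refine lt_of_le_of_ne (part_antitone l hik.le) fun h => ?_
    have hn : ((Multiset.range l.length).map l.part).Nodup := by
      rw [← parts_eq_map]; exact hl
    have := Multiset.inj_on_of_nodup_map hn k (by simpa using hk) i (by simpa using hi) h
    omega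
  · have h1 := (part_pos_iff l i).2 hi
    have h2 := mt (part_pos_iff l k).1 (by omega)
    omega

end Ptn

/-! ### Beta-sets and shifts -/

/-- Adding a bead at the bottom of a set of beads. -/
def shiftBeads (B : Finset ℕ) : Finset ℕ := insert 0 (B.image (· + 1))

theorem zero_mem_shiftBeads (B : Finset ℕ) : 0 ∈ shiftBeads B := by simp [shiftBeads]

theorem succ_mem_shiftBeads {B : Finset ℕ} {p : ℕ} : p + 1 ∈ shiftBeads B ↔ p ∈ B := by
  simp [shiftBeads]

theorem betaSet_succ (l : Ptn) {n : ℕ} (hn : l.length ≤ n) :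
    betaSet l (n + 1) = shiftBeads (betaSet l n) := by
  have h0 : l.part n = 0 := by
    have := mt (Ptn.part_pos_iff l n).1 (by omega)
    omega
  ext x
  simp only [betaSet, shiftBeads, Finset.mem_image, Finset.mem_range, Finset.mem_insert]
  constructor
  · rintro ⟨i, hi, rfl⟩
    rcases Nat.lt_or_ge i n with h | h
    · exact Or.inr ⟨_, ⟨i, h, rfl⟩, by omega⟩
    · obtain rfl : i = n := by omega
      left; omega
  · rintro (rfl | ⟨_, ⟨i, hi, rfl⟩, rfl⟩)
    · exact ⟨n, by omega, by omega⟩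
    · exact ⟨i, by omega, by omega⟩

theorem ptnOfBeads_shiftBeads (B : Finset ℕ) : ptnOfBeads (shiftBeads B) = ptnOfBeads B := by
  have h0 : (0 : ℕ) ∉ B.image (· + 1) := by simp
  have hinj : Set.InjOn (fun x : ℕ => x + 1) B := fun a _ b _ h => by simpa using h
  have hc : ∀ p, ((shiftBeads B).filter (fun q => q < p + 1)).card =
      (B.filter (fun q => q < p)).card + 1 := by
    intro p
    rw [shiftBeads, Finset.filter_insert, if_pos (by omega), Finset.card_insert_of_notMem (by simp),
      Finset.filter_image, Finset.card_image_of_injective _ (add_left_injective 1)]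
    simp
  have hv : (shiftBeads B).val = 0 ::ₘ B.val.map (· + 1) := by
    rw [shiftBeads, Finset.insert_val_of_notMem h0, Finset.image_val_of_injOn hinj]
  have : ((shiftBeads B).val.map
      (fun p => p - ((shiftBeads B).filter (fun q => q < p)).card)) =
      0 ::ₘ B.val.map (fun p => p - (B.filter (fun q => q < p)).card) := by
    rw [hv, Multiset.map_cons, Multiset.map_map]
    congr 1
    · simp
    · refine Multiset.map_congr rfl fun p _ => ?_
      simp only [Function.comp, hc]
      omega
  simp only [ptnOfBeads, this, Ptn.of]
  congr 1
  exact Multiset.filter_cons_of_neg _ (lt_irrefl 0)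

theorem betaSet_ptnOfBeads (B : Finset ℕ) : betaSet (ptnOfBeads B) B.card = B := by
  classical
  set n := B.card with hn
  set b : ℕ → ℕ := Nat.nth (· ∈ B)
  have hfin : {x | x ∈ B}.Finite := B.finite_toSet
  have hcard : hfin.toFinset.card = n := by
    rw [hn]; congr 1; ext; simp
  have hbm : ∀ k < n, b k ∈ B := fun k hk => Nat.nth_mem k fun _ => by rw [hcard]; exact hk
  have hcount : ∀ p, (B.filter (fun q => q < p)).card = Nat.count (· ∈ B) p := by
    intro p
    rw [Nat.count_eq_card_filter_range]
    congr 1; ext q; simp [and_comm]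
  have hrank : ∀ k < n, Nat.count (· ∈ B) (b k) = k := fun k hk =>
    Nat.count_nth fun _ => by rw [hcard]; exact hk
  have hmono : ∀ j k, j < k → k < n → b j < b k := fun j k hjk hk =>
    Nat.nth_lt_nth_of_lt_card hfin hjk (by rw [hcard]; exact hk)
  have himg : (Finset.range n).image b = B := by
    refine Finset.eq_of_subset_of_card_le ?_ ?_
    · intro x hx
      obtain ⟨k, hk, rfl⟩ := Finset.mem_image.1 hx
      exact hbm k (Finset.mem_range.1 hk)
    · rw [Finset.card_image_of_injOn, Finset.card_range]
      intro j hj k hk h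
      have hj' : j < n := by simpa using hj
      have hk' : k < n := by simpa using hk
      have h' : b j = b k := h
      rw [← hrank j hj', ← hrank k hk', h']
  have hge : ∀ k < n, k ≤ b k := fun k hk => by
    conv_lhs => rw [← hrank k hk]
    exact Nat.count_le _
  have hdiff : ∀ d k, k + d < n → b k - k ≤ b (k + d) - (k + d) := by
    intro d
    induction d with
    | zero => intro k _; simp
    | succ d ih =>
      intro k hk
      have h1 := ih k (by omega)
      have h2 := hmono (k + d) (k + (d + 1)) (by omega) hk
      have h3 := hge (k + d) (by omega)
      omega
  set f : ℕ → ℕ := fun i => if i < n then b (n - 1 - i) - (n - 1 - i) else 0 with hf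
  have hanti : Antitone f := by
    intro i k hik
    simp only [hf]
    split_ifs with h1 h2
    · have := hdiff (k - i) (n - 1 - k) (by omega)
      rwa [show n - 1 - k + (k - i) = n - 1 - i by omega] at this
    · omega
    · omega
    · omega
  have hparts : ptnOfBeads B = Ptn.of ((Multiset.range n).map f) := by
    unfold ptnOfBeads
    congr 1
    have h1 : B.val = (Multiset.range n).map (fun i => b (n - 1 - i)) := by
      have e : (Finset.range n).image (fun i => b (n - 1 - i)) = B := by
        conv_rhs => rw [← himg]
        ext x
        simp only [Finset.mem_image, Finset.mem_range]
        constructor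
        · rintro ⟨i, hi, rfl⟩
          exact ⟨n - 1 - i, by omega, rfl⟩
        · rintro ⟨i, hi, rfl⟩
          exact ⟨n - 1 - i, by omega, by congr 1; omega⟩
      conv_lhs => rw [← e]
      rw [Finset.image_val_of_injOn, Finset.range_val]
      apply Finset.injOn_of_card_image_eq
      rw [e, Finset.card_range]
    have h2 : ∀ p, p - (B.filter (fun q => q < p)).card = p - Nat.count (· ∈ B) p := by
      intro p; rw [hcount]
    simp only [h2]
    rw [h1, Multiset.map_map]
    refine Multiset.map_congr rfl fun i hi => ?_
    have hi' : i < n := by simpa using hi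
    simp only [Function.comp, hf, if_pos hi']
    rw [hrank _ (by omega)]
  unfold betaSet
  rw [hparts]
  conv_rhs => rw [← himg]
  ext x
  simp only [Finset.mem_image, Finset.mem_range]
  have key : ∀ i < n, (Ptn.of ((Multiset.range n).map f)).part i + (n - 1 - i) = b (n - 1 - i) := by
    intro i hi
    rw [Ptn.part_of_map_range hanti (fun i hi => by simp [hf, hi])]
    simp only [hf, if_pos hi]
    have := hge (n - 1 - i) (by omega)
    omega
  constructor
  · rintro ⟨i, hi, rfl⟩
    exact ⟨n - 1 - i, by omega, (key i hi).symm⟩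
  · rintro ⟨i, hi, rfl⟩
    refine ⟨n - 1 - i, by omega, ?_⟩
    rw [key _ (by omega)]
    congr 1; omega

theorem length_ptnOfBeads_le (B : Finset ℕ) : (ptnOfBeads B).length ≤ B.card := by
  unfold ptnOfBeads Ptn.of Ptn.length
  refine (Multiset.card_le_card (Multiset.filter_le _ _)).trans ?_
  simp

theorem rKey_two_shiftBeads (B : Finset ℕ) (p : ℕ) :
    rKey 2 (shiftBeads (shiftBeads B)) (p + 2) = rKey 2 B p + 2 := by
  have h : (shiftBeads (shiftBeads B)).filter (fun q => q % 2 = (p + 2) % 2 ∧ q < p + 2) =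
      insert (p % 2) ((B.filter (fun q => q % 2 = p % 2 ∧ q < p)).image (· + 2)) := by
    ext x
    simp only [Finset.mem_filter, Finset.mem_insert, Finset.mem_image]
    rcases x with _ | _ | x
    · simp [zero_mem_shiftBeads]
    · simp [zero_mem_shiftBeads, succ_mem_shiftBeads]
    · have hx : x + 1 + 1 ≠ p % 2 := by omega
      simp [succ_mem_shiftBeads, hx]
      omega
  unfold rKey
  rw [h, Finset.card_insert_of_notMem,
    Finset.card_image_of_injective _ (add_left_injective 2)]
  · omega
  · simp; omega

theorem inversions_rKey_two_shiftBeads (B : Finset ℕ) :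
    inversions (rKey 2 (shiftBeads (shiftBeads B))) (shiftBeads (shiftBeads B)) =
      inversions (rKey 2 B) B := by
  have h0 : rKey 2 (shiftBeads (shiftBeads B)) 0 = 0 := by simp [rKey]
  have h1 : rKey 2 (shiftBeads (shiftBeads B)) 1 = 1 := by
    simp [rKey]
    intro x _ h hx
    omega
  unfold inversions
  conv_rhs => rw [← Finset.card_image_of_injective _ (add_left_injective ((2, 2) : ℕ × ℕ))]
  congr 1
  ext ⟨p, q⟩
  simp only [Finset.mem_filter, Finset.mem_image, Finset.mem_product, Prod.exists, Prod.mk_add_mk,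
    Prod.mk.injEq]
  constructor
  · rintro ⟨⟨hp, hq⟩, hpq, hk⟩
    rcases p with _ | _ | p
    · omega
    · rcases q with _ | _ | q
      · omega
      · omega
      · have := rKey_two_shiftBeads B q
        simp only [zero_add] at hk
        rw [add_assoc, one_add_one_eq_two] at hk
        omega
    · rcases q with _ | _ | q
      · omega
      · omega
      · have e1 := rKey_two_shiftBeads B q
        have e2 := rKey_two_shiftBeads B p
        simp only [add_assoc, one_add_one_eq_two] at hk
        refine ⟨p, q, ⟨⟨?_, ?_⟩, ?_, ?_⟩, rfl, rfl⟩
        · simpa [succ_mem_shiftBeads] using hp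
        · simpa [succ_mem_shiftBeads] using hq
        · omega
        · omega
  · rintro ⟨p, q, ⟨⟨hp, hq⟩, hpq, hk⟩, rfl, rfl⟩
    rw [rKey_two_shiftBeads, rKey_two_shiftBeads]
    refine ⟨⟨?_, ?_⟩, by omega, by omega⟩
    · exact succ_mem_shiftBeads.2 (succ_mem_shiftBeads.2 hp)
    · exact succ_mem_shiftBeads.2 (succ_mem_shiftBeads.2 hq)

/-- The `2`-sign can be read off any abacus with an even number of beads. -/
theorem inversions_betaSet_even (l : Ptn) {c : ℕ} (hc : l.length ≤ 2 * c) :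
    inversions (rKey 2 (betaSet l (2 * c))) (betaSet l (2 * c)) = rSignExp 2 l := by
  have step : ∀ a d, l.length ≤ 2 * a →
      inversions (rKey 2 (betaSet l (2 * (a + d)))) (betaSet l (2 * (a + d))) =
      inversions (rKey 2 (betaSet l (2 * a))) (betaSet l (2 * a)) := by
    intro a d ha
    induction d with
    | zero => rfl
    | succ d ih =>
      rw [← ih, show 2 * (a + (d + 1)) = 2 * (a + d) + 1 + 1 by ring,
        betaSet_succ l (by omega), betaSet_succ l (by omega), inversions_rKey_two_shiftBeads]
  unfold rSignExp
  rcases le_total c l.length with h | h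
  · obtain ⟨d, hd⟩ := Nat.exists_eq_add_of_le h
    conv_rhs => rw [hd]
    exact (step c d hc).symm
  · obtain ⟨d, hd⟩ := Nat.exists_eq_add_of_le h
    rw [hd]
    exact step l.length d (by omega)

theorem rSignExp_two_ptnOfBeads {B : Finset ℕ} {c : ℕ} (hc : B.card = 2 * c) :
    rSignExp 2 (ptnOfBeads B) = inversions (rKey 2 B) B := by
  have h := inversions_betaSet_even (ptnOfBeads B) (hc ▸ length_ptnOfBeads_le B)
  rw [← hc, betaSet_ptnOfBeads] at h
  exact h.symm

/-! ### The double of a strict partition -/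

/-- The rows of the double of a strict partition. -/
def doubleRow (l : Ptn) (i : ℕ) : ℕ :=
  (if i < l.length then l.part i + 1 else 0) +
    ((Finset.range (min i l.length)).filter (fun j => i + 1 ≤ j + l.part j)).card

theorem Ptn.Strict.add_part_antitone {l : Ptn} (hl : l.Strict) {j k : ℕ} (hjk : j ≤ k)
    (hk : k < l.length) : k + l.part k ≤ j + l.part j := by
  induction k, hjk using Nat.le_induction with
  | base => exact le_rfl
  | succ k hjk ih =>
    have h1 := ih (by omega)
    have h2 := hl.part_lt (Nat.lt_succ_self k) (by omega)
    simp only [Nat.succ_eq_add_one] at h2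
    omega

theorem doubleRow_of_lt {l : Ptn} (hl : l.Strict) {i : ℕ} (hi : i < l.length) :
    doubleRow l i = l.part i + 1 + i := by
  have h : (Finset.range (min i l.length)).filter (fun j => i + 1 ≤ j + l.part j) =
      Finset.range i := by
    ext j
    simp only [Finset.mem_filter, Finset.mem_range]
    constructor
    · rintro ⟨h, _⟩; omega
    · intro hj
      have h1 := hl.add_part_antitone hj.le hi
      have h2 := (Ptn.part_pos_iff l i).2 hi
      omega
  rw [doubleRow, if_pos hi, h, Finset.card_range]

/-- Below the Durfee square, the row lengths count an initial segment of legs. -/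
theorem lt_doubleRow_iff {l : Ptn} (hl : l.Strict) {i : ℕ} (hi : l.length ≤ i) (j : ℕ) :
    j < doubleRow l i ↔ j < l.length ∧ i + 1 ≤ j + l.part j := by
  rw [doubleRow, if_neg (by omega), zero_add, min_eq_right hi]
  constructor
  · intro hj
    by_contra! hc
    have : (Finset.range l.length).filter (fun j => i + 1 ≤ j + l.part j) ⊆ Finset.range j := by
      intro k hk
      simp only [Finset.mem_filter, Finset.mem_range] at hk ⊢
      by_contra! hjk
      have h1 := hl.add_part_antitone hjk hk.1
      have h2 := hc (by omega)
      omega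
    have := Finset.card_le_card this
    rw [Finset.card_range] at this
    omega
  · rintro ⟨hj, hj'⟩
    have : Finset.range (j + 1) ⊆
        (Finset.range l.length).filter (fun j => i + 1 ≤ j + l.part j) := by
      intro k hk
      simp only [Finset.mem_filter, Finset.mem_range] at hk ⊢
      have h1 := hl.add_part_antitone (show k ≤ j by omega) hj
      omega
    have := Finset.card_le_card this
    rw [Finset.card_range] at this
    omega

theorem doubleRow_le_length {l : Ptn} {i : ℕ} (hi : l.length ≤ i) :
    doubleRow l i ≤ l.length := by
  rw [doubleRow, if_neg (by omega), zero_add, min_eq_right hi]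
  exact (Finset.card_filter_le _ _).trans (by simp)

theorem doubleRow_antitone {l : Ptn} (hl : l.Strict) : Antitone (doubleRow l) := by
  refine antitone_nat_of_succ_le fun i => ?_
  rcases Nat.lt_or_ge (i + 1) l.length with h | h
  · rw [doubleRow_of_lt hl h, doubleRow_of_lt hl (by omega)]
    have := hl.part_lt (Nat.lt_succ_self i) (by omega)
    simp only [Nat.succ_eq_add_one] at this
    omega
  · rcases Nat.lt_or_ge i l.length with h' | h'
    · have := doubleRow_le_length h
      rw [doubleRow_of_lt hl h']
      omega
    · refine le_of_forall_lt fun j hj => ?_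
      rw [lt_doubleRow_iff hl h] at hj
      rw [lt_doubleRow_iff hl h']
      exact ⟨hj.1, by omega⟩

theorem doubleRow_eq_zero {l : Ptn} (hl : l.Strict) {i : ℕ} (hi : l.length + l.part 0 ≤ i) :
    doubleRow l i = 0 := by
  by_contra h
  have h1 := (lt_doubleRow_iff hl (by omega) 0).1 (Nat.pos_of_ne_zero h)
  omega

theorem double_part {l : Ptn} (hl : l.Strict) (i : ℕ) : (double l).part i = doubleRow l i :=
  Ptn.part_of_map_range (doubleRow_antitone hl) (fun _ h => doubleRow_eq_zero hl h) i

theorem part_zero_le_length_double {l : Ptn} (hl : l.Strict) :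
    l.part 0 ≤ (double l).length := by
  by_contra! h
  have h1 := mt (Ptn.part_pos_iff (double l) (double l).length).1 (lt_irrefl _)
  rw [double_part hl] at h1
  have hpos := (Ptn.part_pos_iff l 0).1 (by omega)
  rcases Nat.lt_or_ge (double l).length l.length with h2 | h2
  · rw [doubleRow_of_lt hl h2] at h1
    omega
  · exact h1 ((lt_doubleRow_iff hl h2 0).2 ⟨hpos, by omega⟩)

theorem Ptn.Strict.length_le_part_zero {l : Ptn} (hl : l.Strict) : l.length ≤ l.part 0 := by
  rcases Nat.eq_zero_or_pos l.length with h | h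
  · omega
  · have h1 := hl.add_part_antitone (Nat.zero_le (l.length - 1)) (by omega)
    have h2 := (Ptn.part_pos_iff l (l.length - 1)).2 (by omega)
    omega

/-- In Frobenius coordinates, the double has beads at `M + λ_i` and holes at `M - λ_i`. -/
theorem mem_betaSet_double {l : Ptn} (hl : l.Strict) {M : ℕ} (hM : l.part 0 ≤ M) (x : ℕ) :
    x ∈ betaSet (double l) M ↔
      (x < M ∧ M - x ∉ l.parts) ∨ (M ≤ x ∧ x - M ∈ l.parts) := by
  have hlen := hl.length_le_part_zero
  have hle : ∀ j, l.part j ≤ l.part 0 := fun j => Ptn.part_antitone l (Nat.zero_le j)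
  have hhigh : ∀ i < l.length, doubleRow l i + (M - 1 - i) = M + l.part i := by
    intro i hi
    rw [doubleRow_of_lt hl hi]
    omega
  have hlow : (Finset.Ico l.length M).image (fun i => doubleRow l i + (M - 1 - i)) =
      Finset.range M \ (Finset.range l.length).image (fun j => M - l.part j) := by
    refine Finset.eq_of_subset_of_card_le ?_ ?_
    · intro x hx
      simp only [Finset.mem_image, Finset.mem_Ico, Finset.mem_sdiff, Finset.mem_range] at hx ⊢
      obtain ⟨i, ⟨hi, hiM⟩, rfl⟩ := hx
      have hc := doubleRow_le_length hi
      refine ⟨by omega, ?_⟩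
      rintro ⟨j, hj, hjx⟩
      have h1 := lt_doubleRow_iff hl hi j
      have h2 := hle j
      by_cases hlt : j < doubleRow l i
      · have := (h1.1 hlt).2
        omega
      · have : ¬ (i + 1 ≤ j + l.part j) := fun h => hlt (h1.2 ⟨hj, h⟩)
        omega
    · rw [Finset.card_image_of_injOn, Nat.card_Ico]
      · rw [Finset.card_sdiff_of_subset, Finset.card_range, Finset.card_image_of_injOn,
          Finset.card_range]
        · intro i hi j hj hij
          simp only [Finset.coe_range, Set.mem_Iio] at hi hj hij
          have h1 := hle i
          have h2 := hle j
          rcases lt_trichotomy i j with h | h | h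
          · have := hl.part_lt h hi; omega
          · exact h
          · have := hl.part_lt h hj; omega
        · intro x hx
          simp only [Finset.mem_image, Finset.mem_range] at hx ⊢
          obtain ⟨j, hj, rfl⟩ := hx
          have := (Ptn.part_pos_iff l j).2 hj
          omega
      · intro i hi j hj hij
        simp only [Finset.coe_Ico, Set.mem_Ico] at hi hj hij
        rcases lt_trichotomy i j with h | h | h
        · have := doubleRow_antitone hl h.le; omega
        · exact h
        · have := doubleRow_antitone hl h.le; omega
  have hsplit : x ∈ betaSet (double l) M ↔ (∃ i < l.length, M + l.part i = x) ∨
      x ∈ (Finset.Ico l.length M).image (fun i => doubleRow l i + (M - 1 - i)) := by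
    simp only [betaSet, double_part hl, Finset.mem_image, Finset.mem_range, Finset.mem_Ico]
    constructor
    · rintro ⟨i, hi, rfl⟩
      rcases Nat.lt_or_ge i l.length with h | h
      · exact Or.inl ⟨i, h, (hhigh i h).symm⟩
      · exact Or.inr ⟨i, ⟨h, hi⟩, rfl⟩
    · rintro (⟨i, hi, rfl⟩ | ⟨i, ⟨_, hi⟩, rfl⟩)
      · exact ⟨i, by omega, hhigh i hi⟩
      · exact ⟨i, hi, rfl⟩
  rw [hsplit, hlow]
  simp only [Ptn.mem_parts_iff, Finset.mem_sdiff, Finset.mem_range, Finset.mem_image]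
  constructor
  · rintro (⟨i, hi, rfl⟩ | ⟨hx, hn⟩)
    · exact Or.inr ⟨by omega, i, hi, by omega⟩
    · refine Or.inl ⟨hx, ?_⟩
      rintro ⟨i, hi, h⟩
      exact hn ⟨i, hi, by omega⟩
  · rintro (⟨hx, hn⟩ | ⟨hx, i, hi, h⟩)
    · refine Or.inr ⟨hx, ?_⟩
      rintro ⟨i, hi, h⟩
      have := hle i
      exact hn ⟨i, hi, by omega⟩
    · exact Or.inl ⟨i, hi, by omega⟩

theorem mem_runnerLevels (r : ℕ) (l : Ptn) (k s : ℕ) (hr : 0 < r) :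
    s ∈ runnerLevels r l k ↔ r * s + k ∈ betaSet l (r * l.length) := by
  unfold runnerLevels
  rw [Finset.mem_filter, Finset.mem_range, and_iff_right_iff_imp]
  intro h
  simp only [betaSet, Finset.mem_image, Finset.mem_range] at h
  obtain ⟨i, hi, h⟩ := h
  have h1 := Ptn.part_antitone l (Nat.zero_le i)
  have h2 := Nat.le_mul_of_pos_left s hr
  omega

/-! ### Symmetric bead sets -/

/-- The bead set on `K + 2 * ℓ` positions, filled below `K`, whose remaining positions are
symmetric about the centre `K + ℓ` with holes at distance index `i ∈ E`. -/
def symBeads (ℓ : ℕ) (E : Finset ℕ) (K : ℕ) : Finset ℕ :=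
  (Finset.range (K + 2 * ℓ)).filter
    (fun s => if s < K + ℓ then K + ℓ - 1 - s ∉ E else s - (K + ℓ) ∉ E)

theorem symBeads_succ {ℓ : ℕ} {E : Finset ℕ} (hE : E ⊆ Finset.range ℓ) (K : ℕ) :
    symBeads ℓ E (K + 1) = shiftBeads (symBeads ℓ E K) := by
  ext x
  cases x with
  | zero =>
    simp only [zero_mem_shiftBeads, iff_true, symBeads, Finset.mem_filter, Finset.mem_range]
    refine ⟨by omega, ?_⟩
    rw [if_pos (by omega)]
    intro h
    have := Finset.mem_range.1 (hE h)
    omega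
  | succ x =>
    rw [succ_mem_shiftBeads]
    simp only [symBeads, Finset.mem_filter, Finset.mem_range]
    rw [show K + 1 + ℓ - 1 - (x + 1) = K + ℓ - 1 - x by omega,
      show x + 1 - (K + 1 + ℓ) = x - (K + ℓ) by omega]
    simp only [show x + 1 < K + 1 + 2 * ℓ ↔ x < K + 2 * ℓ by omega,
      show x + 1 < K + 1 + ℓ ↔ x < K + ℓ by omega]

theorem ptnOfBeads_symBeads {ℓ : ℕ} {E : Finset ℕ} (hE : E ⊆ Finset.range ℓ) (K : ℕ) :
    ptnOfBeads (symBeads ℓ E K) = ptnOfBeads (symBeads ℓ E 0) := by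
  induction K with
  | zero => rfl
  | succ K ih => rw [symBeads_succ hE, ptnOfBeads_shiftBeads, ih]

/-! ### Strict partitions obtained from `Λ_ℓ` -/

/-- The set of parts `3 k + 1 + [k ∈ E]`, for `k < ℓ`. -/
def lamParts (ℓ : ℕ) (E : Finset ℕ) : Finset ℕ :=
  (Finset.range ℓ).image (fun k => 3 * k + 1 + if k ∈ E then 1 else 0)

theorem LamP_part (ℓ i : ℕ) : (LamP ℓ).part i = if i < ℓ then 3 * (ℓ - 1 - i) + 1 else 0 := by
  have h : LamP ℓ = Ptn.of ((Multiset.range ℓ).map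
      (fun i => if i < ℓ then 3 * (ℓ - 1 - i) + 1 else 0)) := by
    unfold LamP
    congr 1
    have h1 : (Finset.range ℓ).image (fun i => ℓ - 1 - i) = Finset.range ℓ := by
      ext x
      simp only [Finset.mem_image, Finset.mem_range]
      constructor
      · rintro ⟨i, hi, rfl⟩; omega
      · intro hx
        exact ⟨ℓ - 1 - x, by omega, by omega⟩
    have h2 : (Multiset.range ℓ).map (fun i => ℓ - 1 - i) = Multiset.range ℓ := by
      have := congrArg Finset.val h1
      rwa [Finset.image_val_of_injOn (Finset.injOn_of_card_image_eq (by rw [h1])),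
        Finset.range_val] at this
    conv_lhs => rw [← h2]
    rw [Multiset.map_map]
    refine Multiset.map_congr rfl fun i hi => ?_
    rw [Multiset.mem_range] at hi
    simp [hi]
  rw [h, Ptn.part_of_map_range]
  · intro i k hik
    dsimp only
    split_ifs <;> omega
  · intro i hi
    exact if_neg (by omega)

theorem exists_lamParts {ℓ m : ℕ} {μ : Ptn} (hμ : μ ∈ F1Lam ℓ m) :
    ∃ E ⊆ Finset.range ℓ, E.card = m ∧ μ.parts.toFinset = lamParts ℓ E := by
  obtain ⟨-, hcont, hsize, hcell⟩ := hμ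
  have hge : ∀ i < ℓ, 3 * (ℓ - 1 - i) + 1 ≤ μ.part i := by
    intro i hi
    have := hcont i
    rwa [LamP_part, if_pos hi] at this
  have hle : ∀ i < ℓ, μ.part i ≤ 3 * (ℓ - 1 - i) + 2 := by
    intro i hi
    by_contra! h
    have := hcell i (3 * (ℓ - 1 - i) + 2) (by rw [LamP_part, if_pos hi]; omega) h
    omega
  have hlen : ∀ l : Ptn, (∀ i, 0 < l.part i ↔ i < ℓ) → l.length = ℓ := by
    intro l h
    refine eq_of_forall_lt_iff fun i => ?_
    rw [← Ptn.part_pos_iff, h]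
  have hμlen : μ.length = ℓ := by
    refine hlen μ fun i => ⟨fun h => ?_, fun h => by have := hge i h; omega⟩
    by_contra! hi
    have := hcell i 0 (by rw [LamP_part, if_neg (by omega)]) h
    omega
  have hΛlen : (LamP ℓ).length = ℓ := by
    refine hlen _ fun i => ?_
    rw [LamP_part]
    split_ifs with h <;> simp [h]
  set E := (Finset.range ℓ).filter (fun k => μ.part (ℓ - 1 - k) = 3 * k + 2) with hE
  have hpart : ∀ k < ℓ, μ.part (ℓ - 1 - k) = 3 * k + 1 + if k ∈ E then 1 else 0 := by
    intro k hk
    have h1 := hge (ℓ - 1 - k) (by omega)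
    have h2 := hle (ℓ - 1 - k) (by omega)
    rw [show ℓ - 1 - (ℓ - 1 - k) = k by omega] at h1 h2
    simp only [hE, Finset.mem_filter, Finset.mem_range, hk, true_and]
    split_ifs <;> omega
  refine ⟨E, Finset.filter_subset _ _, ?_, ?_⟩
  · rw [Ptn.size_eq_sum, Ptn.size_eq_sum, hμlen, hΛlen, ← Finset.sum_range_reflect,
      ← Finset.sum_range_reflect (fun i => (LamP ℓ).part i)] at hsize
    have e1 : ∑ j ∈ Finset.range ℓ, μ.part (ℓ - 1 - j) =
        ∑ j ∈ Finset.range ℓ, (3 * j + 1) + E.card := by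
      rw [Finset.sum_congr rfl fun j hj => hpart j (Finset.mem_range.1 hj),
        Finset.sum_add_distrib]
      congr 1
      rw [Finset.sum_ite_mem, Finset.inter_eq_right.2 (Finset.filter_subset _ _)]
      exact (Finset.card_eq_sum_ones E).symm
    have e2 : ∑ j ∈ Finset.range ℓ, (LamP ℓ).part (ℓ - 1 - j) =
        ∑ j ∈ Finset.range ℓ, (3 * j + 1) := by
      refine Finset.sum_congr rfl fun j hj => ?_
      have := Finset.mem_range.1 hj
      rw [LamP_part, if_pos (by omega)]
      omega
    omega
  · ext x
    rw [Multiset.mem_toFinset, Ptn.mem_parts_iff, hμlen]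
    simp only [lamParts, Finset.mem_image, Finset.mem_range]
    constructor
    · rintro ⟨i, hi, rfl⟩
      refine ⟨ℓ - 1 - i, by omega, ?_⟩
      rw [← hpart _ (by omega)]
      congr 1; omega
    · rintro ⟨k, hk, rfl⟩
      exact ⟨ℓ - 1 - k, by omega, hpart k hk⟩

theorem mem_lamParts_one {ℓ : ℕ} {E : Finset ℕ} {k : ℕ} :
    3 * k + 1 ∈ lamParts ℓ E ↔ k < ℓ ∧ k ∉ E := by
  simp only [lamParts, Finset.mem_image, Finset.mem_range]
  constructor
  · rintro ⟨j, hj, h⟩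
    split_ifs at h with hjE
    · omega
    · obtain rfl : j = k := by omega
      exact ⟨hj, hjE⟩
  · rintro ⟨hk, hkE⟩
    exact ⟨k, hk, by simp [hkE]⟩

theorem mem_lamParts_two {ℓ : ℕ} {E : Finset ℕ} {k : ℕ} :
    3 * k + 2 ∈ lamParts ℓ E ↔ k < ℓ ∧ k ∈ E := by
  simp only [lamParts, Finset.mem_image, Finset.mem_range]
  constructor
  · rintro ⟨j, hj, h⟩
    split_ifs at h with hjE
    · obtain rfl : j = k := by omega
      exact ⟨hj, hjE⟩
    · omega
  · rintro ⟨hk, hkE⟩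
    exact ⟨k, hk, by simp [hkE]⟩

theorem barQuot1_eq {ℓ : ℕ} {E : Finset ℕ} (hE : E ⊆ Finset.range ℓ) {μ : Ptn}
    (hs : μ.Strict) (hμ : μ.parts.toFinset = lamParts ℓ E) :
    barQuot1 μ = ptnOfBeads (symBeads ℓ E 0) := by
  set L := (double μ).length with hL
  have h0 : μ.part 0 ≤ L := part_zero_le_length_double hs
  have hmem : ∀ x, x ∈ μ.parts ↔ x ∈ lamParts ℓ E := fun x => by
    rw [← hμ, Multiset.mem_toFinset]
  have hlen : ℓ ≤ μ.length := by
    have h1 : (lamParts ℓ E).card = ℓ := by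
      rw [lamParts, Finset.card_image_of_injOn, Finset.card_range]
      intro i _ j _ h
      dsimp only at h
      split_ifs at h <;> omega
    calc ℓ = μ.parts.toFinset.card := by rw [hμ, h1]
      _ ≤ μ.length := Multiset.toFinset_card_le _
  have hℓL : ℓ ≤ L := hlen.trans (hs.length_le_part_zero.trans h0)
  obtain ⟨K, hK⟩ := Nat.exists_eq_add_of_le hℓL
  rw [← ptnOfBeads_symBeads hE K, barQuot1, quotP]
  congr 1
  ext s
  rw [mem_runnerLevels _ _ _ _ (by norm_num), mem_betaSet_double hs (by omega), ← hL, hmem, hmem]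
  simp only [symBeads, Finset.mem_filter, Finset.mem_range]
  rcases Nat.lt_or_ge s L with h | h
  · rw [show 3 * L - (3 * s + 1) = 3 * (K + ℓ - 1 - s) + 2 by omega, mem_lamParts_two,
      if_pos (by omega)]
    have : K + ℓ - 1 - s ∈ E → K + ℓ - 1 - s < ℓ := fun h => Finset.mem_range.1 (hE h)
    constructor
    · rintro (⟨_, h2⟩ | ⟨h2, _⟩)
      · exact ⟨by omega, fun h3 => h2 ⟨this h3, h3⟩⟩
      · omega
    · rintro ⟨_, h2⟩
      exact Or.inl ⟨by omega, fun h3 => h2 h3.2⟩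
  · rw [show 3 * s + 1 - 3 * L = 3 * (s - (K + ℓ)) + 1 by omega, mem_lamParts_one,
      if_neg (by omega)]
    constructor
    · rintro (⟨h2, _⟩ | ⟨_, h2, h3⟩)
      · omega
      · exact ⟨by omega, h3⟩
    · rintro ⟨h2, h3⟩
      exact Or.inr ⟨by omega, by omega, h3⟩

/-! ### Parity of inversions -/

/-- The rank of a bead among the beads on its runner. -/
def runnerRank (r : ℕ) (B : Finset ℕ) (p : ℕ) : ℕ :=
  (B.filter (fun q => q % r = p % r ∧ q < p)).card

theorem runnerRank_lt {r : ℕ} {B : Finset ℕ} {p q : ℕ} (hp : p ∈ B) (hr : p % r = q % r)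
    (hpq : p < q) : runnerRank r B p < runnerRank r B q := by
  refine Finset.card_lt_card ?_
  rw [Finset.ssubset_iff_of_subset]
  · exact ⟨p, by simp [hp, hr, hpq], by simp⟩
  · intro x hx
    simp only [Finset.mem_filter] at hx ⊢
    exact ⟨hx.1, hx.2.1.trans hr, hx.2.2.trans hpq⟩

theorem eq_of_runnerRank_eq {r : ℕ} {B : Finset ℕ} {p q : ℕ} (hp : p ∈ B) (hq : q ∈ B)
    (hr : p % r = q % r) (h : runnerRank r B p = runnerRank r B q) : p = q := by
  rcases lt_trichotomy p q with hlt | heq | hlt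
  · exact absurd h (runnerRank_lt hp hr hlt).ne
  · exact heq
  · exact absurd h (runnerRank_lt hq hr.symm hlt).ne'

theorem runnerRank_lt_card {r : ℕ} {B : Finset ℕ} {p : ℕ} (hp : p ∈ B) :
    runnerRank r B p < (B.filter (fun q => q % r = p % r)).card := by
  refine Finset.card_lt_card ?_
  rw [Finset.ssubset_iff_of_subset]
  · exact ⟨p, by simp [hp], by simp⟩
  · intro x hx
    simp only [Finset.mem_filter] at hx ⊢
    exact ⟨hx.1, hx.2.1⟩

theorem sum_runnerRank {M : Type*} [AddCommMonoid M] (r : ℕ) (B : Finset ℕ) (k : ℕ) (f : ℕ → M) :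
    ∑ p ∈ B.filter (fun q => q % r = k), f (runnerRank r B p) =
      ∑ j ∈ Finset.range (B.filter (fun q => q % r = k)).card, f j := by
  have hinj : Set.InjOn (runnerRank r B) (B.filter (fun q => q % r = k)) := by
    intro p hp q hq h
    simp only [Finset.coe_filter, Set.mem_ofPred_eq] at hp hq
    exact eq_of_runnerRank_eq hp.1 hq.1 (hp.2.trans hq.2.symm) h
  have himg : (B.filter (fun q => q % r = k)).image (runnerRank r B) =
      Finset.range (B.filter (fun q => q % r = k)).card := by
    refine Finset.eq_of_subset_of_card_le ?_ ?_
    · intro x hx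
      obtain ⟨p, hp, rfl⟩ := Finset.mem_image.1 hx
      rw [Finset.mem_filter] at hp
      have := runnerRank_lt_card (r := r) hp.1
      rw [hp.2] at this
      exact Finset.mem_range.2 this
    · rw [Finset.card_image_of_injOn hinj, Finset.card_range]
  rw [← himg, Finset.sum_image hinj]

theorem card_filter_key_lt {key : ℕ → ℕ} {B : Finset ℕ} (hinj : Set.InjOn key B)
    (hlt : ∀ p ∈ B, key p < B.card) {p : ℕ} (hp : p ∈ B) :
    (B.filter (fun q => key q < key p)).card = key p := by
  have himg : B.image key = Finset.range B.card := by
    refine Finset.eq_of_subset_of_card_le ?_ ?_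
    · intro x hx
      obtain ⟨q, hq, rfl⟩ := Finset.mem_image.1 hx
      exact Finset.mem_range.2 (hlt q hq)
    · rw [Finset.card_image_of_injOn hinj, Finset.card_range]
  have h2 : (B.filter (fun q => key q < key p)).image key = Finset.range (key p) := by
    ext x
    simp only [Finset.mem_image, Finset.mem_filter, Finset.mem_range]
    constructor
    · rintro ⟨q, ⟨_, h⟩, rfl⟩; exact h
    · intro hx
      have : x ∈ B.image key := by
        rw [himg, Finset.mem_range]
        exact hx.trans (hlt p hp)
      obtain ⟨q, hq, rfl⟩ := Finset.mem_image.1 this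
      exact ⟨q, ⟨hq, hx⟩, rfl⟩
  rw [← Finset.card_image_of_injOn (hinj.mono (Finset.coe_subset.2 (Finset.filter_subset _ _))), h2, Finset.card_range]

/-- The parity of a shuffle of two increasing sequences is the total displacement of the
elements of one of them. -/
theorem inversions_mod_two {key : ℕ → ℕ} {B : Finset ℕ} (χ : ℕ → Prop) [DecidablePred χ]
    (hmono : ∀ p ∈ B, ∀ q ∈ B, (χ p ↔ χ q) → p < q → key p < key q)
    (hinj : Set.InjOn key B) (hlt : ∀ p ∈ B, key p < B.card) :
    (inversions key B : ZMod 2) =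
      ∑ p ∈ B.filter χ, (((B.filter (fun q => q < p)).card : ZMod 2) + (key p : ZMod 2)) := by
  set v : ℕ → ℕ → ZMod 2 := fun p q => if p < q ∧ key q < key p then 1 else 0 with hv
  have hv0 : ∀ p ∈ B, ∀ q ∈ B, (χ p ↔ χ q) → v p q = 0 := by
    intro p hp q hq hχ
    refine if_neg fun h => ?_
    have := hmono p hp q hq hχ h.1
    omega
  have hL : (inversions key B : ZMod 2) = ∑ p ∈ B, ∑ q ∈ B, v p q := by
    rw [inversions, Finset.natCast_card_filter, Finset.sum_product]
  have hR : ∀ p ∈ B.filter χ,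
      ((B.filter (fun q => q < p)).card : ZMod 2) + (key p : ZMod 2) =
        ∑ q ∈ B.filter (fun q => ¬ χ q), (v p q + v q p) := by
    intro p hp
    rw [Finset.mem_filter] at hp
    conv_lhs => rw [← card_filter_key_lt hinj hlt hp.1]
    rw [Finset.natCast_card_filter, Finset.natCast_card_filter, ← Finset.sum_add_distrib,
      ← Finset.sum_filter_add_sum_filter_not B χ, Finset.sum_eq_zero, zero_add]
    · refine Finset.sum_congr rfl fun q hq => ?_
      rw [Finset.mem_filter] at hq
      have hne : p ≠ q := fun h => hq.2 (h ▸ hp.2)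
      have hkne : key p ≠ key q := fun h => hne (hinj hp.1 hq.1 h)
      simp only [hv]
      rcases lt_or_gt_of_ne hne with h1 | h1 <;> rcases lt_or_gt_of_ne hkne with h2 | h2 <;>
        simp [h1, h2, h1.not_gt, h2.not_gt, CharTwo.add_self_eq_zero]
    · intro q hq
      rw [Finset.mem_filter] at hq
      rcases lt_trichotomy p q with h | h | h
      · have := hmono p hp.1 q hq.1 (by simp [hp.2, hq.2]) h
        simp [h.not_gt, this.not_gt]
      · simp [h]
      · have := hmono q hq.1 p hp.1 (by simp [hp.2, hq.2]) h
        simp [h, this, CharTwo.add_self_eq_zero]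
  rw [hL, Finset.sum_congr rfl hR, ← Finset.sum_filter_add_sum_filter_not B χ]
  simp only [Finset.sum_add_distrib]
  congr 1
  · refine Finset.sum_congr rfl fun p hp => ?_
    rw [Finset.mem_filter] at hp
    rw [← Finset.sum_filter_add_sum_filter_not B χ, Finset.sum_eq_zero, zero_add]
    intro q hq
    rw [Finset.mem_filter] at hq
    exact hv0 p hp.1 q hq.1 (by simp [hp.2, hq.2])
  · rw [Finset.sum_comm (s := B.filter χ)]
    refine Finset.sum_congr rfl fun p hp => ?_
    rw [Finset.mem_filter] at hp
    rw [← Finset.sum_filter_add_sum_filter_not B χ, add_eq_left]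
    refine Finset.sum_eq_zero fun q hq => ?_
    rw [Finset.mem_filter] at hq
    exact hv0 p hp.1 q hq.1 (by simp [hp.2, hq.2])

theorem inversions_rKey_two {B : Finset ℕ} {c : ℕ} (hB : B.card = 2 * c)
    (h1 : (B.filter (fun q => q % 2 = 1)).card = c) :
    (inversions (rKey 2 B) B : ZMod 2) =
      ∑ p ∈ B.filter (fun q => q % 2 = 1), ((B.filter (fun q => q < p)).card : ZMod 2) + c := by
  have h0 : (B.filter (fun q => q % 2 = 0)).card = c := by
    have := Finset.card_filter_add_card_filter_not (s := B) (fun q => q % 2 = 1)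
    simp only [Nat.mod_two_not_eq_one] at this
    omega
  have hkey : ∀ p, rKey 2 B p = 2 * runnerRank 2 B p + p % 2 := fun p => rfl
  have hlt : ∀ p ∈ B, runnerRank 2 B p < c := by
    intro p hp
    have := runnerRank_lt_card (r := 2) hp
    rcases Nat.mod_two_eq_zero_or_one p with h | h <;> rw [h] at this <;> omega
  rw [inversions_mod_two (fun q => q % 2 = 1), Finset.sum_add_distrib]
  · congr 1
    have : ∀ p ∈ B.filter (fun q => q % 2 = 1), (rKey 2 B p : ZMod 2) = 1 := by
      intro p hp
      rw [hkey, (Finset.mem_filter.1 hp).2, Nat.cast_add, two_mul, Nat.cast_add,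
        CharTwo.add_self_eq_zero, zero_add, Nat.cast_one]
    rw [Finset.sum_congr rfl this, Finset.sum_const, h1, nsmul_one]
  · intro p hp q hq hχ hpq
    have := runnerRank_lt (r := 2) hp (by omega) hpq
    rw [hkey, hkey]
    omega
  · intro p hp q hq h
    rw [hkey, hkey] at h
    exact eq_of_runnerRank_eq (r := 2) hp hq (by omega) (by omega)
  · intro p hp
    have := hlt p hp
    rw [hkey]
    omega

theorem barKey_of_mod_ne_zero {B : Finset ℕ} (h0 : ∀ p ∈ B, p % 3 ≠ 0) {p : ℕ} (hp : p ∈ B) :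
    barKey B p =
      if runnerRank 3 B p < min (B.filter (fun q => q % 3 = 1)).card
          (B.filter (fun q => q % 3 = 2)).card then
        (if p % 3 = 2 then 2 * runnerRank 3 B p else 2 * runnerRank 3 B p + 1)
      else min (B.filter (fun q => q % 3 = 1)).card (B.filter (fun q => q % 3 = 2)).card +
        runnerRank 3 B p := by
  have hn : (B.filter (fun q => q % 3 = 0)).card = 0 := by
    rw [Finset.card_eq_zero, Finset.filter_eq_empty_iff]
    exact fun p hp => h0 p hp
  have hr : (B.filter (fun q => q % 3 = p % 3 ∧ q < p)).card = runnerRank 3 B p := rfl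
  unfold barKey
  simp only [if_neg (h0 p hp), hn, hr, zero_add]
  split_ifs <;> omega

theorem inversions_barKey {B : Finset ℕ} (h0 : ∀ p ∈ B, p % 3 ≠ 0) {a b : ℕ}
    (h1 : (B.filter (fun q => q % 3 = 1)).card = a)
    (h2 : (B.filter (fun q => q % 3 = 2)).card = b) :
    (inversions (barKey B) B : ZMod 2) =
      ∑ p ∈ B.filter (fun q => q % 3 = 2), ((B.filter (fun q => q < p)).card : ZMod 2) +
        ∑ j ∈ Finset.range b, if j < min a b then (0 : ZMod 2) else ((min a b + j : ℕ) : ZMod 2) := by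
  have hkey := @barKey_of_mod_ne_zero B h0
  rw [h1, h2] at hkey
  have hmod : ∀ p ∈ B, p % 3 = 1 ∨ p % 3 = 2 := by
    intro p hp
    have := h0 p hp
    omega
  have hrk : ∀ p ∈ B, (p % 3 = 1 ∧ runnerRank 3 B p < a) ∨ (p % 3 = 2 ∧ runnerRank 3 B p < b) := by
    intro p hp
    have := runnerRank_lt_card (r := 3) hp
    rcases hmod p hp with h | h <;> rw [h] at this <;> omega
  have hcard : B.card = a + b := by
    have := Finset.card_filter_add_card_filter_not (s := B) (fun q => q % 3 = 1)
    rw [← this, h1, ← h2]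
    congr 2
    refine Finset.filter_congr fun p hp => ?_
    have := hmod p hp
    omega
  rw [inversions_mod_two (fun q => q % 3 = 2), Finset.sum_add_distrib]
  · congr 1
    rw [← h2, ← sum_runnerRank, h2]
    refine Finset.sum_congr rfl fun p hp => ?_
    rw [Finset.mem_filter] at hp
    rw [hkey hp.1, if_pos hp.2]
    split_ifs
    · rw [two_mul, Nat.cast_add, CharTwo.add_self_eq_zero]
    · rfl
  · intro p hp q hq hχ hpq
    have e1 := hrk p hp
    have e2 := hrk q hq
    have := runnerRank_lt (r := 3) hp (by omega) hpq
    rw [hkey hp, hkey hq]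
    split_ifs <;> omega
  · intro p hp q hq h
    have e1 := hrk p hp
    have e2 := hrk q hq
    rw [hkey hp, hkey hq] at h
    have : p % 3 = q % 3 ∧ runnerRank 3 B p = runnerRank 3 B q := by
      split_ifs at h <;> omega
    exact eq_of_runnerRank_eq hp hq this.1 this.2
  · intro p hp
    have e1 := hrk p hp
    rw [hkey hp, hcard]
    split_ifs <;> omega

theorem sum_symBeads {M : Type*} [AddCommMonoid M] (ℓ : ℕ) (E : Finset ℕ) (f : ℕ → M) :
    ∑ p ∈ symBeads ℓ E 0, f p =
      ∑ i ∈ Finset.range ℓ \ E, (f (ℓ + i) + f (ℓ - 1 - i)) := by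
  have h : symBeads ℓ E 0 = (Finset.range ℓ \ E).image (fun i => ℓ + i) ∪
      (Finset.range ℓ \ E).image (fun i => ℓ - 1 - i) := by
    ext x
    simp only [symBeads, Finset.mem_filter, Finset.mem_range, Finset.mem_union, Finset.mem_image,
      Finset.mem_sdiff, zero_add]
    constructor
    · rintro ⟨hx, hE⟩
      split_ifs at hE with hlt
      · exact Or.inr ⟨ℓ - 1 - x, ⟨by omega, hE⟩, by omega⟩
      · exact Or.inl ⟨x - ℓ, ⟨by omega, hE⟩, by omega⟩
    · rintro (⟨i, ⟨hi, hE⟩, rfl⟩ | ⟨i, ⟨hi, hE⟩, rfl⟩)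
      · refine ⟨by omega, ?_⟩
        rw [if_neg (by omega), show ℓ + i - ℓ = i by omega]
        exact hE
      · refine ⟨by omega, ?_⟩
        rw [if_pos (by omega), show ℓ - 1 - (ℓ - 1 - i) = i by omega]
        exact hE
  rw [h, Finset.sum_union, Finset.sum_image, Finset.sum_image, Finset.sum_add_distrib]
  · intro i hi j hj hij
    simp only [Finset.coe_sdiff, Finset.coe_range, Set.mem_sdiff, Set.mem_Iio] at hi hj hij
    omega
  · intro i _ j _ hij
    simpa using hij
  · rw [Finset.disjoint_left]
    simp only [Finset.mem_image, Finset.mem_sdiff, Finset.mem_range]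
    rintro _ ⟨i, ⟨hi, _⟩, rfl⟩ ⟨j, ⟨hj, _⟩, h⟩
    omega

theorem sum_card_filter_lt (Z : Finset ℕ) :
    ∑ i ∈ Z, ((Z.filter (fun k => k < i)).card : ZMod 2) = (Z.card.choose 2 : ℕ) := by
  have h := sum_runnerRank 1 Z 0 (fun j => (j : ZMod 2))
  simp only [runnerRank, Nat.mod_one, true_and, Finset.filter_true] at h
  rw [h, ← Nat.cast_sum, Finset.sum_range_id, Nat.choose_two_right]

theorem card_symBeads {ℓ c : ℕ} {E : Finset ℕ} (hc : (Finset.range ℓ \ E).card = c) :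
    (symBeads ℓ E 0).card = 2 * c := by
  rw [Finset.card_eq_sum_ones, sum_symBeads, Finset.sum_const, hc, smul_eq_mul, mul_comm]

theorem inversions_symBeads {ℓ c : ℕ} {E : Finset ℕ} (hc : (Finset.range ℓ \ E).card = c) :
    (inversions (rKey 2 (symBeads ℓ E 0)) (symBeads ℓ E 0) : ZMod 2) =
      c + (c.choose 2 : ℕ) + c * ℓ + ∑ i ∈ Finset.range ℓ \ E, (i : ZMod 2) := by
  set Z := Finset.range ℓ \ E with hZ
  have hZlt : ∀ i ∈ Z, i < ℓ := fun i hi => Finset.mem_range.1 (Finset.mem_sdiff.1 hi).1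
  have hodd : ((symBeads ℓ E 0).filter (fun q => q % 2 = 1)).card = c := by
    rw [Finset.card_filter, sum_symBeads, ← hZ, ← hc, Finset.card_eq_sum_ones]
    refine Finset.sum_congr rfl fun i hi => ?_
    have := hZlt i hi
    split_ifs <;> omega
  have hup : ∀ i ∈ Z, (((symBeads ℓ E 0).filter (fun q => q < ℓ + i)).card : ZMod 2) =
      (Z.filter (fun k => k < i)).card + c := by
    intro i hi
    rw [Finset.natCast_card_filter, sum_symBeads, Finset.sum_add_distrib, ← hZ, ← hc]
    congr 1
    · simp
    · rw [Finset.sum_congr rfl fun j hj => if_pos (by have := hZlt j hj; omega)]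
      simp
  have hdown : ∀ i ∈ Z, (((symBeads ℓ E 0).filter (fun q => q < ℓ - 1 - i)).card : ZMod 2) =
      (Z.filter (fun k => k < i)).card + c + 1 := by
    intro i hi
    have hil := hZlt i hi
    have h1 : ((symBeads ℓ E 0).filter (fun q => q < ℓ - 1 - i)).card +
        (Z.filter (fun k => k < i)).card + 1 = c := by
      rw [Finset.card_filter, sum_symBeads, Finset.card_filter, ← hZ, ← hc,
        Finset.card_eq_sum_ones]
      have h2 : (1 : ℕ) = ∑ j ∈ Z, if j = i then 1 else 0 := by simp [hi]
      conv_lhs => rw [h2]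
      rw [← Finset.sum_add_distrib, ← Finset.sum_add_distrib]
      refine Finset.sum_congr rfl fun j hj => ?_
      have := hZlt j hj
      split_ifs <;> omega
    rw [← h1]
    push_cast
    generalize (((symBeads ℓ E 0).filter (fun q => q < ℓ - 1 - i)).card : ZMod 2) = x
    generalize ((Z.filter (fun k => k < i)).card : ZMod 2) = y
    revert x y
    decide
  rw [inversions_rKey_two (card_symBeads hc) hodd, Finset.sum_filter, sum_symBeads, ← hZ]
  have hterm : ∀ i ∈ Z,
      ((if (ℓ + i) % 2 = 1 then
          (((symBeads ℓ E 0).filter (fun q => q < ℓ + i)).card : ZMod 2) else 0) +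
        if (ℓ - 1 - i) % 2 = 1 then
          (((symBeads ℓ E 0).filter (fun q => q < ℓ - 1 - i)).card : ZMod 2) else 0) =
      ((Z.filter (fun k => k < i)).card : ZMod 2) + (i : ZMod 2) + (c + ℓ + 1) := by
    intro i hi
    have hil := hZlt i hi
    rw [hup i hi, hdown i hi]
    rcases Nat.mod_two_eq_zero_or_one (ℓ + i) with h | h
    · have hc2 : ((ℓ + i : ℕ) : ZMod 2) = 0 := by
        rw [← ZMod.natCast_mod, h, Nat.cast_zero]
      rw [if_neg (by omega), if_pos (by omega)]
      push_cast at hc2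
      linear_combination -hc2
    · have hc2 : ((ℓ + i : ℕ) : ZMod 2) = 1 := by
        rw [← ZMod.natCast_mod, h, Nat.cast_one]
      rw [if_pos h, if_neg (by omega)]
      push_cast at hc2
      linear_combination -hc2 - (CharTwo.two_eq_zero : (2 : ZMod 2) = 0)
  rw [Finset.sum_congr rfl hterm, Finset.sum_add_distrib, Finset.sum_add_distrib,
    sum_card_filter_lt, Finset.sum_const, hc, nsmul_eq_mul]
  generalize ∑ i ∈ Z, (i : ZMod 2) = w
  generalize ((c.choose 2 : ℕ) : ZMod 2) = u
  generalize (c : ZMod 2) = x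
  generalize (ℓ : ZMod 2) = y
  revert w u x y
  decide

theorem filter_lamParts_two {ℓ : ℕ} {E : Finset ℕ} (hE : E ⊆ Finset.range ℓ) :
    (lamParts ℓ E).filter (fun q => q % 3 = 2) = E.image (fun k => 3 * k + 2) := by
  ext x
  simp only [Finset.mem_filter, Finset.mem_image]
  constructor
  · rintro ⟨hx, h⟩
    rw [show x = 3 * (x / 3) + 2 by omega, mem_lamParts_two] at hx
    exact ⟨_, hx.2, by omega⟩
  · rintro ⟨k, hk, rfl⟩
    exact ⟨mem_lamParts_two.2 ⟨Finset.mem_range.1 (hE hk), hk⟩, by omega⟩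

theorem filter_lamParts_one {ℓ : ℕ} {E : Finset ℕ} :
    (lamParts ℓ E).filter (fun q => q % 3 = 1) =
      (Finset.range ℓ \ E).image (fun k => 3 * k + 1) := by
  ext x
  simp only [Finset.mem_filter, Finset.mem_image, Finset.mem_sdiff, Finset.mem_range]
  constructor
  · rintro ⟨hx, h⟩
    rw [show x = 3 * (x / 3) + 1 by omega, mem_lamParts_one] at hx
    exact ⟨_, hx, by omega⟩
  · rintro ⟨k, hk, rfl⟩
    exact ⟨mem_lamParts_one.2 hk, by omega⟩

theorem card_filter_lamParts_lt {ℓ k : ℕ} (E : Finset ℕ) (hk : k < ℓ) :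
    ((lamParts ℓ E).filter (fun q => q < 3 * k + 1)).card = k := by
  have h : (lamParts ℓ E).filter (fun q => q < 3 * k + 1) = lamParts k E := by
    ext x
    simp only [lamParts, Finset.mem_filter, Finset.mem_image, Finset.mem_range]
    constructor
    · rintro ⟨⟨j, hj, rfl⟩, h⟩
      exact ⟨j, by omega, rfl⟩
    · rintro ⟨j, hj, rfl⟩
      refine ⟨⟨j, by omega, rfl⟩, ?_⟩
      split_ifs <;> omega
  rw [h, lamParts, Finset.card_image_of_injOn, Finset.card_range]
  intro i _ j _ h
  dsimp only at h
  split_ifs at h <;> omega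

theorem inversions_lamParts {ℓ : ℕ} {E : Finset ℕ} (hE : E ⊆ Finset.range ℓ) {c m : ℕ}
    (hc : (Finset.range ℓ \ E).card = c) (hm : E.card = m) :
    (inversions (barKey (lamParts ℓ E)) (lamParts ℓ E) : ZMod 2) =
      ∑ i ∈ E, (i : ZMod 2) + ((m - c).choose 2 : ℕ) := by
  have h0 : ∀ p ∈ lamParts ℓ E, p % 3 ≠ 0 := by
    intro p hp
    simp only [lamParts, Finset.mem_image, Finset.mem_range] at hp
    obtain ⟨k, _, rfl⟩ := hp
    split_ifs <;> omega
  have h1 : ((lamParts ℓ E).filter (fun q => q % 3 = 1)).card = c := by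
    rw [filter_lamParts_one, Finset.card_image_of_injective _ (fun i j h => by simpa using h), hc]
  have h2 : ((lamParts ℓ E).filter (fun q => q % 3 = 2)).card = m := by
    rw [filter_lamParts_two hE, Finset.card_image_of_injective _ (fun i j h => by simpa using h),
      hm]
  rw [inversions_barKey h0 h1 h2]
  congr 1
  · rw [filter_lamParts_two hE, Finset.sum_image (fun i _ j _ h => by simpa using h)]
    refine Finset.sum_congr rfl fun k hk => ?_
    rw [← card_filter_lamParts_lt E (Finset.mem_range.1 (hE hk))]
    congr 2
    refine Finset.filter_congr fun q hq => ?_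
    have hne : q ≠ 3 * k + 1 := by
      rintro rfl
      exact (mem_lamParts_one.1 hq).2 hk
    rw [card_filter_lamParts_lt E (Finset.mem_range.1 (hE hk))]
    omega
  · rcases le_total m c with h | h
    · rw [min_eq_right h, Nat.sub_eq_zero_of_le h]
      rw [Finset.sum_congr rfl fun j hj => if_pos (Finset.mem_range.1 hj)]
      simp
    · obtain ⟨d, rfl⟩ := Nat.exists_eq_add_of_le h
      rw [min_eq_left h, Nat.add_sub_cancel_left, Finset.sum_range_add,
        Finset.sum_congr rfl fun j hj => if_pos (Finset.mem_range.1 hj), Finset.sum_const_zero,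
        zero_add, Nat.choose_two_right, ← Finset.sum_range_id, Nat.cast_sum]
      refine Finset.sum_congr rfl fun j _ => ?_
      rw [if_neg (by omega), ← add_assoc, Nat.cast_add, Nat.cast_add, CharTwo.add_self_eq_zero,
        zero_add]

theorem choose_two_add (a b : ℕ) :
    (a + b).choose 2 = a.choose 2 + b.choose 2 + a * b := by
  induction b with
  | zero => simp
  | succ b ih =>
    rw [← add_assoc, Nat.choose_succ_succ' (a + b) 1, Nat.choose_succ_succ' b 1, Nat.choose_one_right,
      Nat.choose_one_right, ih]
    ring

theorem neg_one_pow_eq_of_cast_eq {a b : ℕ} (h : (a : ZMod 2) = b) : (-1 : ℤ) ^ a = (-1) ^ b := by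
  rw [neg_one_pow_eq_pow_mod_two, neg_one_pow_eq_pow_mod_two (n := b),
    (ZMod.natCast_eq_natCast_iff' a b 2).1 h]

/-- Lemma 6.7: for every `μ ∈ F_1^m(Λ_ℓ)`, `δ_2(μ^b[1]) · δ̄_3(μ)` equals
`(-1)^{C(m,2)}` if `0 ≤ m ≤ ℓ/2`, and `(-1)^{C(ℓ-m+1,2)+(ℓ-m)m}` if `ℓ/2 ≤ m ≤ ℓ`. -/
theorem stmt9 (ℓ m : ℕ) (hℓ : 1 ≤ ℓ) (hm : m ≤ ℓ) (μ : Ptn) (hμ : μ ∈ F1Lam ℓ m) :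
    (2 * m ≤ ℓ →
      rSign 2 (barQuot1 μ) * barSign3 μ = (-1) ^ Nat.choose m 2) ∧
    (ℓ ≤ 2 * m →
      rSign 2 (barQuot1 μ) * barSign3 μ
        = (-1) ^ (Nat.choose (ℓ - m + 1) 2 + (ℓ - m) * m)) := by
  obtain ⟨E, hE, hEm, hparts⟩ := exists_lamParts hμ
  obtain ⟨c, rfl⟩ := Nat.exists_eq_add_of_le hm
  have hc : (Finset.range (m + c) \ E).card = c := by
    rw [Finset.card_sdiff_of_subset hE, Finset.card_range, hEm, Nat.add_sub_cancel_left]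
  have hsum : ∑ i ∈ Finset.range (m + c) \ E, (i : ZMod 2) + ∑ i ∈ E, (i : ZMod 2) =
      ((m + c).choose 2 : ℕ) := by
    rw [Finset.sum_sdiff hE, ← Nat.cast_sum, Finset.sum_range_id, Nat.choose_two_right]
  have htotal : ((rSignExp 2 (barQuot1 μ) + barSignExp μ : ℕ) : ZMod 2) =
      (m.choose 2 + (m - c).choose 2 : ℕ) := by
    rw [barQuot1_eq hE hμ.1 hparts, rSignExp_two_ptnOfBeads (card_symBeads hc), barSignExp, hparts,
      Nat.cast_add, inversions_symBeads hc, inversions_lamParts hE hc hEm]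
    rw [choose_two_add] at hsum
    push_cast at hsum ⊢
    rw [← add_assoc, add_assoc _ _ (∑ i ∈ E, (i : ZMod 2)), hsum]
    generalize ((m - c).choose 2 : ZMod 2) = w
    generalize (m.choose 2 : ZMod 2) = u
    generalize (c.choose 2 : ZMod 2) = v
    generalize (c : ZMod 2) = x
    generalize (m : ZMod 2) = y
    revert w u v x y
    decide
  rw [rSign, barSign3, ← pow_add]
  constructor
  · intro h
    refine neg_one_pow_eq_of_cast_eq (htotal.trans ?_)
    rw [Nat.sub_eq_zero_of_le (by omega)]
    simp
  · intro h
    refine neg_one_pow_eq_of_cast_eq (htotal.trans ?_)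
    obtain ⟨d, rfl⟩ := Nat.exists_eq_add_of_le (show c ≤ m by omega)
    rw [Nat.add_sub_cancel_left, Nat.add_sub_cancel_left, choose_two_add c d, choose_two_add c 1]
    push_cast
    simp only [Nat.choose_eq_zero_of_lt (show 1 < 2 by norm_num)]
    generalize (c.choose 2 : ZMod 2) = u
    generalize (d.choose 2 : ZMod 2) = v
    generalize (c : ZMod 2) = x
    generalize (d : ZMod 2) = y
    revert u v x y
    decide
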